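/- arXiv:1905.05837 — 5 statements merged into one kernel-verified Lean document; each statement's English description precedes it below -/
import Mathlib

section
/- Let xᵢ, x₁, x₂ be points of the Euclidean plane with pairwise distances at least 2 (dist xᵢ x₁ ≥ 2, dist xᵢ x₂ ≥ 2, dist x₁ x₂ ≥ 2), and suppose there exist y ∈ ℝ² and r < 2 with dist y xᵢ = dist y x₁ = dist y x₂ = r. Then the closed segment [x₁, x₂] does not meet the closed unit ball around xᵢ: for every point p in segment ℝ x₁ x₂, dist xᵢ p > 1. (The base of the L-triangle does not intersect the circle around its apex.) -/
/-- The area formula `4 · area · circumradius = product of the sides`, squared, for the triangle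
with vertices `0`, `(a, b)`, `(c, d)` and circumcenter `(u, v)`. -/
lemma four_mul_sq_circumradius_mul_sq_cross (a b c d u v : ℝ)
    (ha : a ^ 2 + b ^ 2 = 2 * (a * u + b * v)) (hc : c ^ 2 + d ^ 2 = 2 * (c * u + d * v)) :
    4 * (u ^ 2 + v ^ 2) * (a * d - b * c) ^ 2 =
      (a ^ 2 + b ^ 2) * (c ^ 2 + d ^ 2) * ((a - c) ^ 2 + (b - d) ^ 2) := by
  have hu : 2 * u * (a * d - b * c) = (a ^ 2 + b ^ 2) * d - (c ^ 2 + d ^ 2) * b := by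
    rw [ha, hc]; ring
  have hv : 2 * v * (a * d - b * c) = (c ^ 2 + d ^ 2) * a - (a ^ 2 + b ^ 2) * c := by
    rw [ha, hc]; ring
  calc 4 * (u ^ 2 + v ^ 2) * (a * d - b * c) ^ 2
      = (2 * u * (a * d - b * c)) ^ 2 + (2 * v * (a * d - b * c)) ^ 2 := by ring
    _ = _ := by rw [hu, hv]; ring

/-- A point of the line through two vertices of a triangle has distance at least the altitude
`|a| |b| / (2 r)` from the third vertex, here placed at the origin. -/
lemma mul_sq_sides_le_four_mul_sq_circumradius_mul_sq_dist (a b c d u v s t : ℝ)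
    (ha : a ^ 2 + b ^ 2 = 2 * (a * u + b * v)) (hc : c ^ 2 + d ^ 2 = 2 * (c * u + d * v))
    (hne : 0 < (a - c) ^ 2 + (b - d) ^ 2) (hst : s + t = 1) :
    (a ^ 2 + b ^ 2) * (c ^ 2 + d ^ 2) ≤
      4 * (u ^ 2 + v ^ 2) * ((s * a + t * c) ^ 2 + (s * b + t * d) ^ 2) := by
  have hcross : (a * d - b * c) ^ 2 ≤
      ((s * a + t * c) ^ 2 + (s * b + t * d) ^ 2) * ((a - c) ^ 2 + (b - d) ^ 2) := by
    obtain rfl : s = 1 - t := by linarith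
    linarith [sq_nonneg (((1 - t) * a + t * c) * (a - c) + ((1 - t) * b + t * d) * (b - d))]
  refine le_of_mul_le_mul_right ?_ hne
  rw [← four_mul_sq_circumradius_mul_sq_cross a b c d u v ha hc, mul_assoc (4 * (u ^ 2 + v ^ 2))]
  exact mul_le_mul_of_nonneg_left hcross (by positivity)

lemma dist_sq_euclidean_plane (x y : EuclideanSpace ℝ (Fin 2)) :
    dist x y ^ 2 = (x 0 - y 0) ^ 2 + (x 1 - y 1) ^ 2 := by
  rw [EuclideanSpace.dist_eq, Real.sq_sqrt (by positivity)]
  simp [Fin.sum_univ_two, Real.dist_eq, sq_abs]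

theorem L_triangle_base_avoids_apex_circle
    (xi x₁ x₂ : EuclideanSpace ℝ (Fin 2))
    (h₁ : dist xi x₁ ≥ 2) (h₂ : dist xi x₂ ≥ 2) (h₁₂ : dist x₁ x₂ ≥ 2)
    (y : EuclideanSpace ℝ (Fin 2)) (r : ℝ) (hr : r < 2)
    (hy₀ : dist y xi = r) (hy₁ : dist y x₁ = r) (hy₂ : dist y x₂ = r) :
    ∀ p ∈ segment ℝ x₁ x₂, dist xi p > 1 := by
  rintro p ⟨s, t, -, -, hst, rfl⟩
  have hr0 : 0 ≤ r := hy₀ ▸ dist_nonneg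
  have e₀ := dist_sq_euclidean_plane y xi
  have e₁ := dist_sq_euclidean_plane y x₁
  have e₂ := dist_sq_euclidean_plane y x₂
  rw [hy₀] at e₀
  rw [hy₁] at e₁
  rw [hy₂] at e₂
  have d₁ := dist_sq_euclidean_plane xi x₁
  have d₂ := dist_sq_euclidean_plane xi x₂
  have dp := dist_sq_euclidean_plane xi (s • x₁ + t • x₂)
  simp only [PiLp.add_apply, PiLp.smul_apply, smul_eq_mul] at dp
  have hbase : 0 < (x₁ 0 - xi 0 - (x₂ 0 - xi 0)) ^ 2 + (x₁ 1 - xi 1 - (x₂ 1 - xi 1)) ^ 2 := by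
    rw [sub_sub_sub_cancel_right, sub_sub_sub_cancel_right, ← dist_sq_euclidean_plane]
    have : 0 < dist x₁ x₂ := by linarith
    positivity
  have key := mul_sq_sides_le_four_mul_sq_circumradius_mul_sq_dist
    (x₁ 0 - xi 0) (x₁ 1 - xi 1) (x₂ 0 - xi 0) (x₂ 1 - xi 1) (y 0 - xi 0) (y 1 - xi 1) s t
    (by linarith) (by linarith) hbase hst
  have f₁ : (x₁ 0 - xi 0) ^ 2 + (x₁ 1 - xi 1) ^ 2 = dist xi x₁ ^ 2 := by rw [d₁]; ring
  have f₂ : (x₂ 0 - xi 0) ^ 2 + (x₂ 1 - xi 1) ^ 2 = dist xi x₂ ^ 2 := by rw [d₂]; ring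
  have fp : (s * (x₁ 0 - xi 0) + t * (x₂ 0 - xi 0)) ^ 2 +
      (s * (x₁ 1 - xi 1) + t * (x₂ 1 - xi 1)) ^ 2 = dist xi (s • x₁ + t • x₂) ^ 2 := by
    rw [dp]
    obtain rfl : s = 1 - t := by linarith
    ring
  rw [f₁, f₂, fp, ← e₀] at key
  have hsides : (2 : ℝ) * 2 ≤ dist xi x₁ * dist xi x₂ :=
    mul_le_mul h₁ h₂ zero_le_two dist_nonneg
  have hle : dist xi x₁ * dist xi x₂ ≤ 2 * r * dist xi (s • x₁ + t • x₂) :=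
    (pow_le_pow_iff_left₀ (by positivity) (by positivity) two_ne_zero).1 (by linarith)
  by_contra! hp
  have hrp : r * dist xi (s • x₁ + t • x₂) ≤ r := mul_le_of_le_one_right hr0 hp
  linarith
end

section
/- Let xᵢ, x₁, x₂ be points of the Euclidean plane with pairwise distances at least 2, and suppose there exist y ∈ ℝ² and r < 2 with dist y xᵢ = dist y x₁ = dist y x₂ = r. Then the reflected point xᵢ' = x₁ + x₂ − xᵢ satisfies dist xᵢ xᵢ' ≥ 2, i.e., ‖(x₁ − xᵢ) + (x₂ − xᵢ)‖ ≥ 2. (The fourth vertex of the parallelogram completing the L-triangle is at distance at least 2 from the apex, so its circle does not overlap the apex circle.) -/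
/-- The Gram identity for a vector `(a, b)` in the plane spanned by `(c, d)` and `(e, f)`. -/
theorem cross_sq_mul_normSq (a b c d e f : ℝ) :
    ((c ^ 2 + d ^ 2) * (e ^ 2 + f ^ 2) - (c * e + d * f) ^ 2) * (a ^ 2 + b ^ 2) =
      (a * c + b * d) ^ 2 * (e ^ 2 + f ^ 2)
        - 2 * (a * c + b * d) * (a * e + b * f) * (c * e + d * f)
        + (a * e + b * f) ^ 2 * (c ^ 2 + d ^ 2) := by
  ring

/-- A triangle with two sides of squared lengths `P`, `Q` at least `4`, inner product `D` of these
sides, and squared circumradius `R < 4`, has squared doubled median `P + Q + 2 * D` at least `4`. -/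
theorem four_le_normSq_add_of_circumradius_lt {P Q D R : ℝ} (hP : 4 ≤ P) (hQ : 4 ≤ Q)
    (hgram : 0 ≤ P * Q - D ^ 2) (hR : R < 4)
    (hcirc : 4 * ((P * Q - D ^ 2) * R) = P * Q * (P + Q - 2 * D)) :
    4 ≤ P + Q + 2 * D := by
  by_contra! h
  have hPQ : 16 ≤ P * Q := by nlinarith
  have hle : P * Q * (P + Q - 2 * D) ≤ 16 * (P * Q - D ^ 2) := by
    rw [← hcirc]
    nlinarith [mul_nonneg hgram (sub_nonneg.2 hR.le)]
  have hD : ((P + Q - 4) / 2) ^ 2 < D ^ 2 := by nlinarith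
  have hs : P * Q * (2 * (P + Q) - 4) ≤ P * Q * (P + Q - 2 * D) :=
    mul_le_mul_of_nonneg_left (by linarith) (by linarith)
  have hneg : P * Q * (2 * (P + Q) - 20) + 4 * (P + Q - 4) ^ 2 < 0 := by nlinarith
  rcases le_total 10 (P + Q) with h10 | h10
  · nlinarith [mul_nonneg (by linarith : 0 ≤ P * Q) (by linarith : 0 ≤ 2 * (P + Q) - 20)]
  · have hamgm := mul_nonneg (sq_nonneg (P - Q)) (sub_nonneg.2 h10)
    have hfactor : 0 ≤ (P + Q - 2) * ((P + Q - 8) * (P + Q + 8)) :=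
      mul_nonneg (by linarith) (mul_nonneg (by linarith) (by linarith))
    nlinarith

theorem L_triangle_reflected_point_far
    (xi x₁ x₂ : EuclideanSpace ℝ (Fin 2))
    (h₁ : dist xi x₁ ≥ 2) (h₂ : dist xi x₂ ≥ 2) (h₁₂ : dist x₁ x₂ ≥ 2)
    (y : EuclideanSpace ℝ (Fin 2)) (r : ℝ) (hr : r < 2)
    (hy₀ : dist y xi = r) (hy₁ : dist y x₁ = r) (hy₂ : dist y x₂ = r) :
    ‖(x₁ - xi) + (x₂ - xi)‖ ≥ 2 := by
  have dist_sq : ∀ p q : EuclideanSpace ℝ (Fin 2),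
      dist p q ^ 2 = (p 0 - q 0) ^ 2 + (p 1 - q 1) ^ 2 := fun p q => by
    rw [EuclideanSpace.dist_sq_eq, Fin.sum_univ_two, Real.dist_eq, Real.dist_eq, sq_abs, sq_abs]
  have hr0 : 0 ≤ r := hy₀ ▸ dist_nonneg
  have e0 := dist_sq y xi
  have e1 := dist_sq y x₁
  have e2 := dist_sq y x₂
  rw [hy₀] at e0
  rw [hy₁] at e1
  rw [hy₂] at e2
  have hP : 4 ≤ (x₁ 0 - xi 0) ^ 2 + (x₁ 1 - xi 1) ^ 2 := by
    nlinarith only [dist_sq xi x₁, h₁]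
  have hQ : 4 ≤ (x₂ 0 - xi 0) ^ 2 + (x₂ 1 - xi 1) ^ 2 := by
    nlinarith only [dist_sq xi x₂, h₂]
  have hu : (y 0 - xi 0) * (x₁ 0 - xi 0) + (y 1 - xi 1) * (x₁ 1 - xi 1) =
      ((x₁ 0 - xi 0) ^ 2 + (x₁ 1 - xi 1) ^ 2) / 2 := by linarith only [e0, e1]
  have hv : (y 0 - xi 0) * (x₂ 0 - xi 0) + (y 1 - xi 1) * (x₂ 1 - xi 1) =
      ((x₂ 0 - xi 0) ^ 2 + (x₂ 1 - xi 1) ^ 2) / 2 := by linarith only [e0, e2]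
  have hcirc := cross_sq_mul_normSq (y 0 - xi 0) (y 1 - xi 1) (x₁ 0 - xi 0) (x₁ 1 - xi 1)
    (x₂ 0 - xi 0) (x₂ 1 - xi 1)
  rw [hu, hv, ← e0] at hcirc
  have key := four_le_normSq_add_of_circumradius_lt
    (D := (x₁ 0 - xi 0) * (x₂ 0 - xi 0) + (x₁ 1 - xi 1) * (x₂ 1 - xi 1)) hP hQ
    (by linarith only [sq_nonneg ((x₁ 0 - xi 0) * (x₂ 1 - xi 1) - (x₁ 1 - xi 1) * (x₂ 0 - xi 0))])
    (by nlinarith only [hr, hr0] : r ^ 2 < 4) (by rw [hcirc]; ring)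
  refine (sq_le_sq₀ zero_le_two (norm_nonneg _)).1 ?_
  rw [EuclideanSpace.real_norm_sq_eq, Fin.sum_univ_two]
  simp only [PiLp.add_apply, PiLp.sub_apply]
  linarith only [key]
end

section
/- Let xᵢ, x₁, x₂ be points of the Euclidean plane with pairwise distances at least 2, and suppose there exist y ∈ ℝ² and r < 2 with dist y xᵢ = dist y x₁ = dist y x₂ = r. Set a = x₁ − xᵢ and b = x₂ − xᵢ. Then the lattice generated by a and b gives a circle packing: for all integers m, n with (m, n) ≠ (0, 0), ‖m • a + n • b‖ ≥ 2. (Every L-triangle can be completed to a fundamental parallelogram of a lattice circle packing.) -/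
theorem four_le_sq_add_sq_add_of_four_mul_sq_le {X Y v : ℝ} (hX : 4 ≤ X) (hY : 4 ≤ Y)
    (hv : 4 * v ^ 2 ≤ X * Y) : 4 ≤ X + Y + 2 * v := by
  by_contra! h
  have hv' : 2 * v < 4 - X - Y := by linarith
  nlinarith [sq_nonneg (X - Y), mul_nonneg (sub_nonneg.2 hX) (sub_nonneg.2 hY)]

/-- A binary quadratic form whose basis vectors make an angle between 60 and 120 degrees takes
values at least 4 at nonzero integer points, provided it does so on the basis. -/
theorem four_le_quadratic_form {P Q u : ℝ} (hP : 4 ≤ P) (hQ : 4 ≤ Q)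
    (hu : 4 * u ^ 2 ≤ P * Q) {m n : ℤ} (hmn : m ≠ 0 ∨ n ≠ 0) :
    4 ≤ (m : ℝ) ^ 2 * P + (n : ℝ) ^ 2 * Q + 2 * (m * n * u) := by
  have key : ∀ k : ℤ, k ≠ 0 → (1 : ℝ) ≤ (k : ℝ) ^ 2 := fun k hk => by
    exact_mod_cast Int.add_one_le_iff.2 (sq_pos_of_ne_zero hk)
  by_cases hm : m = 0
  · have := key n (by tauto)
    subst hm
    push_cast
    nlinarith
  by_cases hn : n = 0
  · have := key m hm
    subst hn
    push_cast
    nlinarith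
  have h₁ := key m hm
  have h₂ := key n hn
  refine four_le_sq_add_sq_add_of_four_mul_sq_le (by nlinarith) (by nlinarith) ?_
  nlinarith [mul_le_mul_of_nonneg_left hu (sq_nonneg ((m : ℝ) * n))]

/-- In terms of the squared sides `P`, `Q`, `P + Q - 2 * u` of a triangle: if the sides are at
least 2 and the circumradius at most 2, the angle between the sides `P` and `Q` is at most 120
degrees; if moreover the side opposite to it is the longest, it is at least 60 degrees. -/
theorem four_mul_sq_le_of_circumradius {P Q u : ℝ} (hP : 4 ≤ P) (hQ : 4 ≤ Q)
    (hR : P * Q * (P + Q - 2 * u) ≤ 16 * (P * Q - u ^ 2)) (huP : 2 * u ≤ P) (huQ : 2 * u ≤ Q) :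
    4 * u ^ 2 ≤ P * Q := by
  have hPQ : 16 ≤ P * Q := by nlinarith
  rcases le_total 0 u with h | h
  · nlinarith [mul_nonneg h (sub_nonneg.2 huP), mul_nonneg (by linarith : 0 ≤ P) (sub_nonneg.2 huQ)]
  · by_contra! hc
    have h₁ : u < -2 := by nlinarith
    nlinarith [mul_pos (by linarith : 0 < P * Q) (by linarith : 0 < P + Q - 2 * u - 12)]

theorem four_le_quadratic_form_of_circumradius {P Q u : ℝ} (hP : 4 ≤ P) (hQ : 4 ≤ Q)
    (hS : 4 ≤ P + Q - 2 * u) (hR : P * Q * (P + Q - 2 * u) ≤ 16 * (P * Q - u ^ 2))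
    {m n : ℤ} (hmn : m ≠ 0 ∨ n ≠ 0) :
    4 ≤ (m : ℝ) ^ 2 * P + (n : ℝ) ^ 2 * Q + 2 * (m * n * u) := by
  by_cases huP : 2 * u ≤ P
  · by_cases huQ : 2 * u ≤ Q
    · exact four_le_quadratic_form hP hQ (four_mul_sq_le_of_circumradius hP hQ hR huP huQ) hmn
    · have := four_le_quadratic_form hQ hS (m := -(m + n)) (n := m)
        (four_mul_sq_le_of_circumradius (u := Q - u) hQ hS (by linarith) (by linarith)
          (by linarith)) (by omega)
      push_cast at this
      linarith
  · by_cases h : P ≤ Q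
    · have := four_le_quadratic_form hP hS (m := -(m + n)) (n := n)
        (four_mul_sq_le_of_circumradius (u := P - u) hP hS (by linarith) (by linarith)
          (by linarith)) (by omega)
      push_cast at this
      linarith
    · have := four_le_quadratic_form hQ hS (m := -(m + n)) (n := m)
        (four_mul_sq_le_of_circumradius (u := Q - u) hQ hS (by linarith) (by linarith)
          (by linarith)) (by omega)
      push_cast at this
      linarith

theorem L_triangle_generates_lattice_packing
    (xi x₁ x₂ : EuclideanSpace ℝ (Fin 2))
    (h₁ : dist xi x₁ ≥ 2) (h₂ : dist xi x₂ ≥ 2) (h₁₂ : dist x₁ x₂ ≥ 2)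
    (y : EuclideanSpace ℝ (Fin 2)) (r : ℝ) (hr : r < 2)
    (hy₀ : dist y xi = r) (hy₁ : dist y x₁ = r) (hy₂ : dist y x₂ = r) :
    ∀ m n : ℤ, (m, n) ≠ (0, 0) → ‖m • (x₁ - xi) + n • (x₂ - xi)‖ ≥ 2 := by
  intro m n hmn
  have hmn' : m ≠ 0 ∨ n ≠ 0 := by
    by_contra! h
    exact hmn (by rw [h.1, h.2])
  have hr0 : 0 ≤ r := hy₀ ▸ dist_nonneg
  have hr4 : r ^ 2 ≤ 4 := by nlinarith
  have hd : ∀ p q : EuclideanSpace ℝ (Fin 2),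
      dist p q ^ 2 = (p 0 - q 0) ^ 2 + (p 1 - q 1) ^ 2 := fun p q => by
    rw [EuclideanSpace.dist_sq_eq, Fin.sum_univ_two, Real.dist_eq, Real.dist_eq, sq_abs, sq_abs]
  have e₀ := hd y xi
  have e₁ := hd y x₁
  have e₂ := hd y x₂
  have f₁ := hd xi x₁
  have f₂ := hd xi x₂
  have f₁₂ := hd x₁ x₂
  rw [hy₀] at e₀
  rw [hy₁] at e₁
  rw [hy₂] at e₂
  have g₁ : 4 ≤ dist xi x₁ ^ 2 := by nlinarith
  have g₂ : 4 ≤ dist xi x₂ ^ 2 := by nlinarith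
  have g₁₂ : 4 ≤ dist x₁ x₂ ^ 2 := by nlinarith
  obtain ⟨a, ha⟩ : ∃ a, a = x₁ 0 - xi 0 := ⟨_, rfl⟩
  obtain ⟨b, hb⟩ : ∃ b, b = x₁ 1 - xi 1 := ⟨_, rfl⟩
  obtain ⟨c, hc⟩ : ∃ c, c = x₂ 0 - xi 0 := ⟨_, rfl⟩
  obtain ⟨d, hd'⟩ : ∃ d, d = x₂ 1 - xi 1 := ⟨_, rfl⟩
  obtain ⟨s, hs⟩ : ∃ s, s = y 0 - xi 0 := ⟨_, rfl⟩
  obtain ⟨t, ht⟩ : ∃ t, t = y 1 - xi 1 := ⟨_, rfl⟩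
  have hP : 4 ≤ a ^ 2 + b ^ 2 := by subst a b; linarith
  have hQ : 4 ≤ c ^ 2 + d ^ 2 := by subst c d; linarith
  have hS : 4 ≤ (a ^ 2 + b ^ 2) + (c ^ 2 + d ^ 2) - 2 * (a * c + b * d) := by
    subst a b c d; linarith
  have hst : r ^ 2 = s ^ 2 + t ^ 2 := by subst s t; exact e₀
  have k₁ : a ^ 2 + b ^ 2 = 2 * (s * a + t * b) := by subst a b s t; linarith
  have k₂ : c ^ 2 + d ^ 2 = 2 * (s * c + t * d) := by subst c d s t; linarith
  have hR : (a ^ 2 + b ^ 2) * (c ^ 2 + d ^ 2) *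
      ((a ^ 2 + b ^ 2) + (c ^ 2 + d ^ 2) - 2 * (a * c + b * d)) ≤
      16 * ((a ^ 2 + b ^ 2) * (c ^ 2 + d ^ 2) - (a * c + b * d) ^ 2) := by
    have i₁ : (a ^ 2 + b ^ 2) * d - (c ^ 2 + d ^ 2) * b = 2 * s * (a * d - b * c) := by
      rw [k₁, k₂]; ring
    have i₂ : (c ^ 2 + d ^ 2) * a - (a ^ 2 + b ^ 2) * c = 2 * t * (a * d - b * c) := by
      rw [k₁, k₂]; ring
    calc _ = ((a ^ 2 + b ^ 2) * d - (c ^ 2 + d ^ 2) * b) ^ 2 +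
          ((c ^ 2 + d ^ 2) * a - (a ^ 2 + b ^ 2) * c) ^ 2 := by ring
      _ = 4 * (a * d - b * c) ^ 2 * r ^ 2 := by rw [i₁, i₂, hst]; ring
      _ ≤ 4 * (a * d - b * c) ^ 2 * 4 := by gcongr
      _ = _ := by ring
  have main := four_le_quadratic_form_of_circumradius hP hQ hS hR hmn'
  have hn : ‖m • (x₁ - xi) + n • (x₂ - xi)‖ ^ 2 =
      (m * a + n * c) ^ 2 + (m * b + n * d) ^ 2 := by
    rw [EuclideanSpace.norm_sq_eq, Fin.sum_univ_two, Real.norm_eq_abs, Real.norm_eq_abs, sq_abs,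
      sq_abs]
    simp [ha, hb, hc, hd']
  refine (sq_le_sq₀ zero_le_two (norm_nonneg _)).1 ?_
  rw [hn]
  linarith
end

section
/- (Theorem of Lagrange.) Let a, b ∈ ℝ² be linearly independent vectors such that for all integers m, n with (m, n) ≠ (0, 0) one has ‖m • a + n • b‖ ≥ 2. Then the area of the fundamental parallelogram satisfies |a₀·b₁ − a₁·b₀| ≥ 2√3. Equivalently, the density of a lattice circle packing is at most π/(2√3), attained by the hexagonal lattice. -/
/-- A reduced binary quadratic form `A x² + 2 B x y + C y²` with `A ≤ 3 C` and coefficients `A, C`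
at least `4` has determinant at least `12`. -/
lemma twelve_le_det_of_reduced {A B C : ℝ} (hA : 4 ≤ A) (hC : 4 ≤ C) (hB : |B| ≤ A / 2)
    (hAC : A ≤ 3 * C) : 12 ≤ A * C - B ^ 2 := by
  have hB2 : B ^ 2 ≤ (A / 2) ^ 2 := sq_le_sq.2 (hB.trans (le_abs_self _))
  have hC2 : 16 ≤ C ^ 2 := by nlinarith
  nlinarith [mul_nonneg (sub_nonneg.2 hA) (sub_nonneg.2 hAC)]

lemma abs_sub_round_div_mul_le {A : ℝ} (hA : 0 < A) (B : ℝ) :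
    |B - round (B / A) * A| ≤ A / 2 := by
  have h : B - round (B / A) * A = (B / A - round (B / A)) * A := by field_simp
  rw [h, abs_mul, abs_of_pos hA]
  nlinarith [abs_sub_round (B / A)]

/-- A binary quadratic form that is at least `4` at every nonzero integer point has determinant at
least `12`. Each reduction step that does not reach a form to which `twelve_le_det_of_reduced`
applies divides the leading coefficient by more than `3`, so the induction is on a bound
`4 * 3 ^ N` for that coefficient. -/
lemma twelve_le_det_of_le_pow {A B C : ℝ} (N : ℕ) (hN : A ≤ 4 * 3 ^ N)
    (h : ∀ m n : ℤ, (m, n) ≠ (0, 0) → 4 ≤ A * m ^ 2 + 2 * B * (m * n) + C * n ^ 2) :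
    12 ≤ A * C - B ^ 2 := by
  induction N generalizing A B C with
  | zero =>
    have hA : 4 ≤ A := by simpa using h 1 0 (by simp)
    set k := round (B / A)
    have hC := h (-k) 1 (by simp)
    push_cast at hC
    have := twelve_le_det_of_reduced hA (C := A * (-k) ^ 2 + 2 * B * (-k * 1) + C * 1 ^ 2) hC
      (abs_sub_round_div_mul_le (by linarith) B) (by linarith)
    linear_combination this
  | succ N ih =>
    have hA : 4 ≤ A := by simpa using h 1 0 (by simp)
    set k := round (B / A)
    have hC := h (-k) 1 (by simp)
    push_cast at hC
    rcases le_or_gt A (3 * (A * (-k) ^ 2 + 2 * B * (-k * 1) + C * 1 ^ 2)) with hAC | hAC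
    · have := twelve_le_det_of_reduced hA hC (abs_sub_round_div_mul_le (by linarith) B) hAC
      linear_combination this
    · have := ih (A := A * (-k) ^ 2 + 2 * B * (-k * 1) + C * 1 ^ 2) (B := B - k * A) (C := A)
        (by rw [pow_succ] at hN; linarith) fun m n hmn => by
          have := h (n - k * m) m (by
            intro h0
            obtain ⟨hn, rfl⟩ := Prod.mk.inj h0
            exact hmn (by simpa using hn))
          push_cast at this
          linear_combination this
      linear_combination this

theorem lagrange_lattice_circle_packing
    (a b : EuclideanSpace ℝ (Fin 2))
    (hli : LinearIndependent ℝ ![a, b])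
    (hpack : ∀ m n : ℤ, (m, n) ≠ (0, 0) → ‖m • a + n • b‖ ≥ 2) :
    |a 0 * b 1 - a 1 * b 0| ≥ 2 * Real.sqrt 3 := by
  have hform : ∀ m n : ℤ, (m, n) ≠ (0, 0) → 4 ≤ (a 0 ^ 2 + a 1 ^ 2) * m ^ 2 +
      2 * (a 0 * b 0 + a 1 * b 1) * (m * n) + (b 0 ^ 2 + b 1 ^ 2) * n ^ 2 := by
    intro m n hmn
    have h : (2 : ℝ) ^ 2 ≤ ‖m • a + n • b‖ ^ 2 := pow_le_pow_left₀ (by norm_num) (hpack m n hmn) 2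
    simp only [EuclideanSpace.real_norm_sq_eq, Fin.sum_univ_two, PiLp.add_apply, PiLp.smul_apply,
      zsmul_eq_mul] at h
    linear_combination h
  obtain ⟨N, hN⟩ := pow_unbounded_of_one_lt (a 0 ^ 2 + a 1 ^ 2) (by norm_num : (1 : ℝ) < 3)
  have hdet := twelve_le_det_of_le_pow N (by nlinarith [sq_nonneg (a 0), sq_nonneg (a 1)]) hform
  refine (pow_le_pow_iff_left₀ (by positivity) (abs_nonneg _) two_ne_zero).1 ?_
  rw [sq_abs, mul_pow, Real.sq_sqrt (by norm_num)]
  linear_combination hdet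
end

section
/- (Thue's theorem, local form.) Let X be a saturated circle packing configuration in the Euclidean plane and let xᵢ ∈ X. Then the area (two-dimensional Lebesgue measure) of the Voronoi cell V(xᵢ) is at least 2√3; equivalently, the local packing density δ(V(xᵢ)) = π / area(V(xᵢ)) is at most π/(2√3). -/
open MeasureTheory Set

/-- The open circular sector of radius `r` at the origin, subtended by the chord that the bisector
of `0` and `w` cuts out of the ball of radius `r`. -/
def chordSector (r : ℝ) (w : ℂ) : Set ℂ :=
  {z | ‖z‖ < r ∧ ‖z‖ * ‖w‖ ^ 2 < 2 * r * (z.re * w.re + z.im * w.im)}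

/-- The part of `chordSector r w` that is at least as close to `0` as to `w`. -/
def chordTriangle (r : ℝ) (w : ℂ) : Set ℂ :=
  chordSector r w ∩ {z | ‖z‖ ≤ ‖z - w‖}

theorem measurableSet_chordSector (r : ℝ) (w : ℂ) : MeasurableSet (chordSector r w) := by
  unfold chordSector
  measurability

theorem measurableSet_chordTriangle (r : ℝ) (w : ℂ) : MeasurableSet (chordTriangle r w) :=
  (measurableSet_chordSector r w).inter
    (measurableSet_le (by fun_prop) (by fun_prop))

theorem norm_le_norm_sub_iff (z w : ℂ) :
    ‖z‖ ≤ ‖z - w‖ ↔ 2 * (z.re * w.re + z.im * w.im) ≤ ‖w‖ ^ 2 := by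
  rw [← sq_le_sq₀ (norm_nonneg _) (norm_nonneg _)]
  simp only [Complex.sq_norm, Complex.normSq_apply, Complex.sub_re, Complex.sub_im]
  constructor <;> intro h <;> nlinarith

theorem mem_chordSector_of_norm_sub_lt {r : ℝ} {z w : ℂ} (hz : ‖z‖ < r) (h : ‖z - w‖ < ‖z‖) :
    z ∈ chordSector r w := by
  refine ⟨hz, ?_⟩
  have h' : ‖w‖ ^ 2 < 2 * (z.re * w.re + z.im * w.im) := by
    rw [← not_le, ← norm_le_norm_sub_iff]
    exact h.not_ge
  have h0 : 0 < ‖z‖ := (norm_nonneg _).trans_lt h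
  have h1 : 0 < z.re * w.re + z.im * w.im := by nlinarith [sq_nonneg ‖w‖]
  nlinarith

/-- Three points at mutual distances at least `2` do not lie in a disk of radius less than
`2 / √3`. -/
theorem disjoint_chordSector {r : ℝ} (hr : 0 < r) (hr2 : r ^ 2 = 4 / 3) {v w : ℂ} (hv : 2 ≤ ‖v‖)
    (hw : 2 ≤ ‖w‖) (hvw : 2 ≤ ‖v - w‖) : Disjoint (chordSector r v) (chordSector r w) := by
  rw [Set.disjoint_left]
  rintro z ⟨-, h1⟩ ⟨-, h2⟩
  have hz : 0 < ‖z‖ := by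
    rw [norm_pos_iff]
    rintro rfl
    simp at h1
  obtain ⟨t, ht, htr⟩ : ∃ t : ℝ, 0 < t ∧ r = t * ‖z‖ := ⟨r / ‖z‖, by positivity, by field_simp⟩
  have hzsq : ‖z‖ ^ 2 = z.re ^ 2 + z.im ^ 2 := by
    rw [Complex.sq_norm, Complex.normSq_apply]; ring
  have key : ∀ u : ℂ, ‖z‖ * ‖u‖ ^ 2 < 2 * r * (z.re * u.re + z.im * u.im) →
      u.re ^ 2 + u.im ^ 2 < 2 * ((t * z.re) * u.re + (t * z.im) * u.im) := by
    intro u hu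
    have : ‖u‖ ^ 2 = u.re ^ 2 + u.im ^ 2 := by
      rw [Complex.sq_norm, Complex.normSq_apply]; ring
    rw [← this]
    refine lt_of_mul_lt_mul_left (hu.trans_eq ?_) hz.le
    rw [htr]; ring
  have k1 := key v h1
  have k2 := key w h2
  have kp : (t * z.re) ^ 2 + (t * z.im) ^ 2 = 4 / 3 := by
    rw [← hr2, htr, mul_pow t ‖z‖, hzsq]; ring
  have four_le : ∀ u : ℂ, 2 ≤ ‖u‖ → 4 ≤ u.re ^ 2 + u.im ^ 2 := by
    intro u hu
    have : ‖u‖ ^ 2 = u.re ^ 2 + u.im ^ 2 := by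
      rw [Complex.sq_norm, Complex.normSq_apply]; ring
    nlinarith
  have d1 := four_le v hv
  have d2 := four_le w hw
  have d3 := four_le (v - w) hvw
  simp only [Complex.sub_re, Complex.sub_im] at d3
  nlinarith [sq_nonneg (v.re + w.re - 3 * (t * z.re)), sq_nonneg (v.im + w.im - 3 * (t * z.im))]

theorem volume_sector_le {r α : ℝ} (hr : 0 ≤ r) (h0 : 0 ≤ α) :
    volume {z : ℂ | ‖z‖ < r ∧ ‖z‖ * Real.cos α < z.re} ≤ ENNReal.ofReal (r ^ 2 * α) := by
  set S := {z : ℂ | ‖z‖ < r ∧ ‖z‖ * Real.cos α < z.re}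
  have hS : MeasurableSet S := by measurability
  rw [← lintegral_indicator_one hS, ← Complex.lintegral_comp_polarCoord_symm]
  calc ∫⁻ p in polarCoord.target, ENNReal.ofReal p.1 • S.indicator 1 (Complex.polarCoord.symm p)
      ≤ ∫⁻ p in polarCoord.target,
          (Ioo 0 r ×ˢ Ioo (-α) α).indicator (fun p : ℝ × ℝ => ENNReal.ofReal p.1) p := by
        refine setLIntegral_mono' polarCoord.open_target.measurableSet ?_
        rintro ⟨ρ, θ⟩ hp
        simp only [polarCoord_target, mem_prod, mem_Ioi, mem_Ioo] at hp
        by_cases hmem : Complex.polarCoord.symm (ρ, θ) ∈ S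
        · have hnorm : ‖Complex.polarCoord.symm (ρ, θ)‖ = ρ := by
            rw [Complex.norm_polarCoord_symm, abs_of_pos hp.1]
          obtain ⟨m1, m2⟩ := hmem
          rw [hnorm] at m1 m2
          have hre : (Complex.polarCoord.symm (ρ, θ)).re = ρ * Real.cos θ := by
            simp [Complex.polarCoord_symm_apply, Complex.cos_ofReal_re]
          rw [hre] at m2
          have hcos : Real.cos α < Real.cos |θ| := by
            rw [Real.cos_abs]; exact lt_of_mul_lt_mul_left m2 hp.1.le
          have hθ : |θ| < α := by
            by_contra! hle
            exact absurd (Real.cos_le_cos_of_nonneg_of_le_pi h0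
              (abs_le.2 ⟨hp.2.1.le, hp.2.2.le⟩) hle) hcos.not_ge
          rw [indicator_of_mem (show (ρ, θ) ∈ Ioo 0 r ×ˢ Ioo (-α) α from
            ⟨⟨hp.1, m1⟩, abs_lt.1 hθ⟩)]
          exact (mul_le_mul_right (indicator_le_self' (by simp) _) _).trans (by simp)
        · rw [indicator_of_notMem hmem]; simp
    _ ≤ ∫⁻ p, (Ioo 0 r ×ˢ Ioo (-α) α).indicator (fun p : ℝ × ℝ => ENNReal.ofReal p.1) p :=
        setLIntegral_le_lintegral _ _
    _ = ∫⁻ p in Ioo 0 r ×ˢ Ioo (-α) α, ENNReal.ofReal p.1 :=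
        lintegral_indicator (measurableSet_Ioo.prod measurableSet_Ioo) _
    _ = ENNReal.ofReal (r ^ 2 * α) := by
        rw [Measure.volume_eq_prod, setLIntegral_prod _ (by fun_prop)]
        simp only [lintegral_const, MeasurableSet.univ, Measure.restrict_apply, univ_inter,
          Real.volume_Ioo]
        rw [lintegral_mul_const _ (by fun_prop),
          ← ofReal_integral_eq_lintegral_ofReal, ← ENNReal.ofReal_mul]
        · rw [← integral_Ioc_eq_integral_Ioo, ← intervalIntegral.integral_of_le hr, integral_id]
          congr 1; ring
        · exact setIntegral_nonneg measurableSet_Ioo fun x hx => hx.1.le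
        · exact (continuous_id.integrableOn_Icc).mono_set Ioo_subset_Icc_self
        · exact (ae_restrict_iff' measurableSet_Ioo).2 (.of_forall fun x hx => hx.1.le)

theorem le_volume_triangle {a k : ℝ} (ha : 0 ≤ a) (hk : 0 ≤ k) :
    ENNReal.ofReal (a ^ 2 * k) ≤ volume {z : ℂ | 0 < z.re ∧ z.re < a ∧ |z.im| < k * z.re} := by
  have h : {z : ℂ | 0 < z.re ∧ z.re < a ∧ |z.im| < k * z.re} =
      Complex.measurableEquivRealProd ⁻¹'
        regionBetween (fun x => -(k * x)) (fun x => k * x) (Ioo 0 a) := by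
    ext z
    simp [regionBetween, Complex.measurableEquivRealProd, abs_lt, and_assoc]
  rw [h, Complex.volume_preserving_equiv_real_prod.measure_preimage_equiv,
    Measure.volume_eq_prod, volume_regionBetween_eq_integral]
  · refine ENNReal.ofReal_le_ofReal (le_of_eq ?_)
    rw [← integral_Ioc_eq_integral_Ioo, ← intervalIntegral.integral_of_le ha]
    simp only [Pi.sub_apply, sub_neg_eq_add]
    rw [show (fun x : ℝ => k * x + k * x) = fun x => (2 * k) * x by ext; ring,
      intervalIntegral.integral_const_mul, integral_id]
    ring
  · exact (Continuous.integrableOn_Icc (by fun_prop)).mono_set Ioo_subset_Icc_self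
  · exact (Continuous.integrableOn_Icc (by fun_prop)).mono_set Ioo_subset_Icc_self
  · exact measurableSet_Ioo
  · intro x hx
    nlinarith [mul_nonneg hk hx.1.le]

theorem le_sin_mul_cos {α : ℝ} (h0 : 0 ≤ α) (hα : α ≤ Real.pi / 6) :
    3 * √3 / (2 * Real.pi) * α ≤ Real.sin α * Real.cos α := by
  have hpi := Real.pi_pos
  have h : (1 - 6 * α / Real.pi) • Real.sin 0 + (6 * α / Real.pi) • Real.sin (Real.pi / 3) ≤
      Real.sin ((1 - 6 * α / Real.pi) • 0 + (6 * α / Real.pi) • (Real.pi / 3)) :=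
    strictConcaveOn_sin_Icc.concaveOn.2 ⟨le_rfl, hpi.le⟩ ⟨by positivity, by linarith⟩
      (by rw [sub_nonneg, div_le_one hpi]; linarith) (by positivity) (by ring)
  simp only [Real.sin_zero, smul_eq_mul, mul_zero, zero_add, Real.sin_pi_div_three] at h
  rw [show 6 * α / Real.pi * (Real.pi / 3) = 2 * α by field_simp; ring, Real.sin_two_mul] at h
  rw [show 3 * √3 / (2 * Real.pi) * α = 6 * α / Real.pi * (√3 / 2) / 2 by field_simp; ring]
  linarith

theorem volume_chordSector_eq (r : ℝ) (w : ℂ) :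
    volume (chordSector r w) = volume (chordSector r (‖w‖ : ℂ)) ∧
      volume (chordTriangle r w) = volume (chordTriangle r (‖w‖ : ℂ)) := by
  obtain ⟨a, ha⟩ : ∃ a : Circle, w = a * (‖w‖ : ℂ) :=
    ⟨Circle.exp w.arg, by rw [Circle.coe_exp, mul_comm, Complex.norm_mul_exp_arg_mul_I]⟩
  have hm : MeasurePreserving (rotation a) volume volume := (rotation a).measurePreserving
  have hd (z : ℂ) : (a * z).re * w.re + (a * z).im * w.im = z.re * ‖w‖ := by
    have hn : (a : ℂ).re * (a : ℂ).re + (a : ℂ).im * (a : ℂ).im = 1 := by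
      rw [← Complex.normSq_apply, Circle.normSq_coe]
    have hre : w.re = (a : ℂ).re * ‖w‖ := by
      conv_lhs => rw [ha]
      simp
    have him : w.im = (a : ℂ).im * ‖w‖ := by
      conv_lhs => rw [ha]
      simp
    simp only [Complex.mul_re, Complex.mul_im]
    rw [hre, him]
    linear_combination z.re * ‖w‖ * hn
  have hs : rotation a ⁻¹' chordSector r w = chordSector r (‖w‖ : ℂ) := by
    ext z
    simp only [chordSector, mem_preimage, mem_ofPred_eq, rotation_apply, norm_mul,
      Circle.norm_coe, one_mul, hd]
    simp
  have ht : rotation a ⁻¹' chordTriangle r w = chordTriangle r (‖w‖ : ℂ) := by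
    rw [chordTriangle, preimage_inter, hs, chordTriangle]
    congr 1
    ext z
    simp only [mem_preimage, mem_ofPred_eq, norm_le_norm_sub_iff, rotation_apply, hd]
    simp
  exact ⟨by rw [← hs, hm.measure_preimage (measurableSet_chordSector r w).nullMeasurableSet],
    by rw [← ht, hm.measure_preimage (measurableSet_chordTriangle r w).nullMeasurableSet]⟩

theorem mul_volume_chordSector_le {r : ℝ} (hr : 0 < r) (hr2 : r ^ 2 = 4 / 3) {w : ℂ}
    (hw : 2 ≤ ‖w‖) :
    ENNReal.ofReal (3 * √3 / (2 * Real.pi)) * volume (chordSector r w) ≤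
      volume (chordTriangle r w) := by
  rw [(volume_chordSector_eq r w).1, (volume_chordSector_eq r w).2]
  set d := ‖w‖
  have hd : 0 < d := by linarith
  rcases le_or_gt (2 * r) d with hdr | hdr
  · have : chordSector r (d : ℂ) = ∅ := by
      rw [eq_empty_iff_forall_notMem]
      rintro z ⟨-, h⟩
      simp only [Complex.norm_real, Real.norm_eq_abs, abs_of_pos hd, Complex.ofReal_re,
        Complex.ofReal_im, mul_zero, add_zero] at h
      have h1 : ‖z‖ * d < 2 * r * z.re := by nlinarith
      nlinarith [Complex.re_le_norm z, norm_nonneg z]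
    simp [this]
  set α := Real.arccos (d / (2 * r))
  have hcos : Real.cos α = d / (2 * r) :=
    Real.cos_arccos (by linarith [show 0 < d / (2 * r) by positivity])
      ((div_le_one (by positivity)).2 hdr.le)
  have hcr : r * Real.cos α = d / 2 := by rw [hcos]; field_simp
  have hc0 : 0 < Real.cos α := by rw [hcos]; positivity
  have h0 : 0 ≤ α := Real.arccos_nonneg _
  have hα : α ≤ Real.pi / 6 := by
    have h3 : √3 / 2 ≤ d / (2 * r) := by
      have : √3 * r = 2 := by
        rw [← sq_eq_sq₀ (by positivity) (by norm_num), mul_pow, hr2, Real.sq_sqrt (by norm_num)]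
        norm_num
      rw [div_le_div_iff₀ (by norm_num) (by positivity)]
      nlinarith
    calc α ≤ Real.arccos (√3 / 2) := Real.arccos_le_arccos h3
      _ = Real.pi / 6 := by
        rw [← Real.cos_pi_div_six, Real.arccos_cos] <;> linarith [Real.pi_pos]
  have hs0 : 0 ≤ Real.sin α := Real.sin_nonneg_of_nonneg_of_le_pi h0 (Real.arccos_le_pi _)
  have mem_iff (z : ℂ) : z ∈ chordSector r (d : ℂ) ↔ ‖z‖ < r ∧ ‖z‖ * Real.cos α < z.re := by
    simp only [chordSector, mem_ofPred_eq, Complex.norm_real, Real.norm_eq_abs, abs_of_pos hd,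
      Complex.ofReal_re, Complex.ofReal_im, mul_zero, add_zero, hcos, and_congr_right_iff]
    intro _
    rw [← mul_div_assoc, div_lt_iff₀ (by positivity), ← mul_lt_mul_iff_left₀ hd (c := z.re * _)]
    ring_nf
  calc _ ≤ ENNReal.ofReal (3 * √3 / (2 * Real.pi)) * ENNReal.ofReal (r ^ 2 * α) := by
        gcongr
        refine (measure_mono fun z hz => (mem_iff z).1 hz).trans
          (volume_sector_le hr.le h0)
    _ ≤ ENNReal.ofReal ((r * Real.cos α) ^ 2 * Real.tan α) := by
        rw [← ENNReal.ofReal_mul (by positivity)]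
        refine ENNReal.ofReal_le_ofReal ?_
        have := mul_le_mul_of_nonneg_left (le_sin_mul_cos h0 hα) (sq_nonneg r)
        calc _ = r ^ 2 * (3 * √3 / (2 * Real.pi) * α) := by ring
          _ ≤ _ := this
          _ = _ := by rw [Real.tan_eq_sin_div_cos]; field_simp
    _ ≤ _ := by
        refine (le_volume_triangle (by positivity)
          (by rw [Real.tan_eq_sin_div_cos]; positivity)).trans (measure_mono ?_)
        rintro z ⟨z0, z1, z2⟩
        have hlt : ‖z‖ * Real.cos α < z.re := by
          have him : |z.im| * Real.cos α < Real.sin α * z.re := by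
            calc _ < Real.tan α * z.re * Real.cos α := by gcongr
              _ = _ := by rw [Real.tan_eq_sin_div_cos]; field_simp
          have hsq : (|z.im| * Real.cos α) ^ 2 < (Real.sin α * z.re) ^ 2 := by gcongr
          refine lt_of_pow_lt_pow_left₀ 2 z0.le ?_
          rw [mul_pow, Complex.sq_norm, Complex.normSq_apply]
          rw [mul_pow, sq_abs, mul_pow] at hsq
          nlinarith [Real.sin_sq_add_cos_sq α]
        have hlr : ‖z‖ < r := lt_of_mul_lt_mul_right (hlt.trans z1) hc0.le
        refine ⟨(mem_iff z).2 ⟨hlr, hlt⟩, ?_⟩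
        rw [mem_ofPred_eq, norm_le_norm_sub_iff]
        simp only [Complex.norm_real, Real.norm_eq_abs, abs_of_pos hd, Complex.ofReal_re,
          Complex.ofReal_im, mul_zero, add_zero]
        nlinarith

theorem countable_of_two_le_norm_sub {X : Set ℂ}
    (hX : ∀ x ∈ X, ∀ y ∈ X, x ≠ y → 2 ≤ ‖x - y‖) : X.Countable := by
  refine Set.PairwiseDisjoint.countable_of_isOpen (s := fun x : ℂ => Metric.ball x 1)
    (fun x hx y hy hxy => ?_) (fun _ _ => Metric.isOpen_ball) fun x _ => ⟨x, by simp⟩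
  refine Metric.ball_disjoint_ball ?_
  rw [dist_eq_norm]
  linarith [hX x hx y hy hxy]

/-- Thue's local bound for the Voronoi cell of the origin in the complex plane. -/
theorem two_mul_sqrt_three_le_volume_voronoi {X : Set ℂ} (h0 : 0 ∈ X)
    (hX : ∀ x ∈ X, ∀ y ∈ X, x ≠ y → 2 ≤ ‖x - y‖) :
    ENNReal.ofReal (2 * √3) ≤ volume {z : ℂ | ∀ w ∈ X, ‖z‖ ≤ ‖z - w‖} := by
  set r : ℝ := √(4 / 3)
  have hr : 0 < r := by positivity
  have hr2 : r ^ 2 = 4 / 3 := Real.sq_sqrt (by norm_num)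
  set c := ENNReal.ofReal (3 * √3 / (2 * Real.pi))
  have hc : c ≤ 1 := by
    rw [← ENNReal.ofReal_one]
    refine ENNReal.ofReal_le_ofReal ((div_le_one (by positivity)).2 ?_)
    nlinarith [Real.pi_gt_three, Real.sq_sqrt (show (0 : ℝ) ≤ 3 by norm_num), Real.sqrt_nonneg 3]
  have : Countable ↑(X \ {0}) := ((countable_of_two_le_norm_sub hX).mono sdiff_subset).to_subtype
  have hnorm (w : ↑(X \ {0})) : 2 ≤ ‖(w : ℂ)‖ := by
    simpa using hX w w.2.1 0 h0 w.2.2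
  have hdisj : Pairwise fun v w : ↑(X \ {0}) =>
      Disjoint (chordSector r (v : ℂ)) (chordSector r (w : ℂ)) := fun v w hvw =>
    disjoint_chordSector hr hr2 (hnorm v) (hnorm w)
      (hX v v.2.1 w w.2.1 fun h => hvw (Subtype.ext h))
  set S := ⋃ w : ↑(X \ {0}), chordSector r (w : ℂ)
  set T := ⋃ w : ↑(X \ {0}), chordTriangle r (w : ℂ)
  have hS : MeasurableSet S := .iUnion fun w => measurableSet_chordSector r w
  have hT : MeasurableSet T := .iUnion fun w => measurableSet_chordTriangle r w
  have hTS : T ⊆ S := iUnion_mono fun w => inter_subset_left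
  have hSB : S ⊆ Metric.ball 0 r := iUnion_subset fun w z hz => by simpa using hz.1
  have hvol : c * volume S ≤ volume T := by
    rw [measure_iUnion hdisj fun w => measurableSet_chordSector r w,
      measure_iUnion (f := fun w : ↑(X \ {0}) => chordTriangle r (w : ℂ))
        (fun v w hvw => (hdisj hvw).mono inter_subset_left inter_subset_left)
        fun w => measurableSet_chordTriangle r w, ← ENNReal.tsum_mul_left]
    exact ENNReal.tsum_le_tsum fun w => mul_volume_chordSector_le hr hr2 (hnorm w)
  have hsub : Metric.ball 0 r \ S ∪ T ⊆ {z : ℂ | ∀ w ∈ X, ‖z‖ ≤ ‖z - w‖} := by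
    intro z hz w hw
    by_contra! hlt
    have hw0 : w ≠ 0 := by rintro rfl; simp at hlt
    rcases hz with ⟨hzr, hzS⟩ | hzT
    · exact hzS (mem_iUnion.2 ⟨⟨w, hw, hw0⟩,
        mem_chordSector_of_norm_sub_lt (by simpa using hzr) hlt⟩)
    · obtain ⟨v, hv, hle⟩ := mem_iUnion.1 hzT
      have hvw : v ≠ ⟨w, hw, hw0⟩ := by rintro rfl; exact hlt.not_ge hle
      exact disjoint_left.1 (hdisj hvw) hv (mem_chordSector_of_norm_sub_lt hv.1 hlt)
  calc ENNReal.ofReal (2 * √3) = c * volume (Metric.ball (0 : ℂ) r) := by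
        rw [Complex.volume_ball, ← ENNReal.ofReal_pow hr.le, hr2, ← ENNReal.ofReal_coe_nnreal,
          ← ENNReal.ofReal_mul (by norm_num), ← ENNReal.ofReal_mul (by positivity)]
        congr 1
        rw [NNReal.coe_real_pi]
        field_simp
        norm_num
    _ = c * volume (Metric.ball (0 : ℂ) r \ S) + c * volume S := by
        rw [← mul_add, ← measure_sdiff_add_inter _ hS, inter_eq_right.2 hSB]
    _ ≤ volume (Metric.ball (0 : ℂ) r \ S) + volume T :=
        add_le_add (mul_le_of_le_one_left' hc) hvol
    _ = volume (Metric.ball (0 : ℂ) r \ S ∪ T) :=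
        (measure_union (disjoint_sdiff_left.mono_right hTS) hT).symm
    _ ≤ _ := measure_mono hsub

theorem thue_local_voronoi_area
    (X : Set (EuclideanSpace ℝ (Fin 2)))
    (hX : ∀ x ∈ X, ∀ y ∈ X, x ≠ y → dist x y ≥ 2)
    (hsat : ∀ Y : Set (EuclideanSpace ℝ (Fin 2)),
      (∀ x ∈ Y, ∀ y ∈ Y, x ≠ y → dist x y ≥ 2) → X ⊆ Y → Y = X)
    (xi : EuclideanSpace ℝ (Fin 2)) (hxi : xi ∈ X) :
    ENNReal.ofReal (2 * Real.sqrt 3) ≤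
      MeasureTheory.volume
        {p : EuclideanSpace ℝ (Fin 2) | ∀ x' ∈ X, dist p xi ≤ dist p x'} := by
  set e : ℂ ≃ₗᵢ[ℝ] EuclideanSpace ℝ (Fin 2) := Complex.orthonormalBasisOneI.repr
  have he : MeasurePreserving (fun z => e z + xi) volume volume :=
    (measurePreserving_add_right volume xi).comp e.measurePreserving
  have hemb : MeasurableEmbedding (fun z => e z + xi) :=
    (e.toHomeomorph.trans (Homeomorph.addRight xi)).measurableEmbedding
  rw [← he.measure_preimage_emb hemb]
  refine (two_mul_sqrt_three_le_volume_voronoi (X := (fun z => e z + xi) ⁻¹' X)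
    (by simpa using hxi) fun x hx y hy hxy => ?_).trans (measure_mono fun z hz x hx => ?_)
  · simpa [dist_eq_norm, ← map_sub] using hX _ hx _ hy (by simpa using hxy)
  · have := hz (e.symm (x - xi)) (by simpa using hx)
    rw [← e.norm_map (z - _), map_sub, e.apply_symm_apply] at this
    rw [dist_eq_norm, dist_eq_norm, add_sub_cancel_right, e.norm_map]
    rwa [sub_sub_eq_add_sub] at this
end
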